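/- arXiv:1410.7864 — 2 statements merged into one kernel-verified Lean document; each statement's English description precedes it below -/
import Mathlib

section
/- Let ω₁ and ω₂ be nonzero alternating 2-forms on a finite-dimensional real vector space V such that ω₁ ∧ ω₂ = 0. Then both ω₁ and ω₂ have rank at most 2, i.e. ω₁ ∧ ω₁ ∧ ω₁ = 0 and ω₂ ∧ ω₂ ∧ ω₂ = 0. -/
set_option synthInstance.maxHeartbeats 1000000
set_option maxHeartbeats 1000000

namespace ExteriorAlgebra

open CliffordAlgebra (contractLeft)

section CommRing

variable {R M : Type*} [CommRing R] [AddCommGroup M] [Module R M]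

@[elab_as_elim]
theorem induction_two_form {P : ExteriorAlgebra R M → Prop} {a : ExteriorAlgebra R M}
    (ha : a ∈ ⋀[R]^2 M) (hι : ∀ u v, P (ι R u * ι R v)) (hadd : ∀ x y, P x → P y → P (x + y)) :
    P a := by
  rw [exteriorPower, pow_two] at ha
  refine Submodule.mul_induction_on ha ?_ hadd
  rintro _ ⟨u, rfl⟩ _ ⟨v, rfl⟩
  exact hι u v

theorem ι_mul_ι_swap (u v : M) : ι R u * ι R v = -(ι R v * ι R u) :=
  eq_neg_of_add_eq_zero_left (ι_add_mul_swap u v)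

theorem commute_ι_of_mem_two {a : ExteriorAlgebra R M} (ha : a ∈ ⋀[R]^2 M) (w : M) :
    Commute a (ι R w) := by
  refine induction_two_form ha (fun u v => ?_) (fun x y hx hy => ?_)
  · rw [commute_iff_eq, mul_assoc, ι_mul_ι_swap v w, mul_neg, ← mul_assoc, ι_mul_ι_swap u w,
      neg_mul, neg_neg, mul_assoc]
  · exact hx.add_left hy

theorem commute_of_mem_two {a b : ExteriorAlgebra R M} (ha : a ∈ ⋀[R]^2 M)
    (hb : b ∈ ⋀[R]^2 M) : Commute a b := by
  refine induction_two_form hb (fun u v => ?_) (fun x y hx hy => ?_)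
  · exact (commute_ι_of_mem_two ha u).mul_right (commute_ι_of_mem_two ha v)
  · exact hx.add_right hy

theorem contractLeft_ι_mul (d : Module.Dual R M) (u : M) (b : ExteriorAlgebra R M) :
    contractLeft d (ι R u * b) = d u • b - ι R u * contractLeft d b :=
  CliffordAlgebra.contractLeft_ι_mul (Q := 0) d u b

theorem contractLeft_ι (d : Module.Dual R M) (u : M) :
    contractLeft d (ι R u) = algebraMap R _ (d u) :=
  CliffordAlgebra.contractLeft_ι (Q := 0) d u

theorem contractLeft_ι_mul_ι (d : Module.Dual R M) (u v : M) :
    contractLeft d (ι R u * ι R v) = ι R (d u • v - d v • u) := by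
  rw [contractLeft_ι_mul, contractLeft_ι, ← Algebra.commutes, ← Algebra.smul_def, map_sub,
    map_smul, map_smul]

/-- Contraction is a derivation on products whose left factor is a 2-form. -/
theorem contractLeft_mul_of_mem_two {a : ExteriorAlgebra R M} (ha : a ∈ ⋀[R]^2 M)
    (d : Module.Dual R M) (b : ExteriorAlgebra R M) :
    contractLeft d (a * b) = contractLeft d a * b + a * contractLeft d b := by
  refine induction_two_form ha (fun u v => ?_) (fun x y hx hy => ?_)
  · rw [mul_assoc, contractLeft_ι_mul, contractLeft_ι_mul, contractLeft_ι_mul_ι]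
    simp only [map_sub, map_smul, mul_sub, sub_mul, smul_mul_assoc, mul_smul_comm, mul_assoc]
    abel
  · rw [add_mul, map_add, hx, hy, map_add]
    simp only [add_mul]
    abel

theorem exists_contractLeft_eq_ι_of_mem_two {a : ExteriorAlgebra R M} (ha : a ∈ ⋀[R]^2 M)
    (d : Module.Dual R M) : ∃ w, contractLeft d a = ι R w := by
  refine induction_two_form ha (fun u v => ?_) (fun x y hx hy => ?_)
  · exact ⟨_, contractLeft_ι_mul_ι d u v⟩
  · obtain ⟨p, hp⟩ := hx
    obtain ⟨q, hq⟩ := hy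
    exact ⟨p + q, by rw [map_add, map_add, hp, hq]⟩

/-- Euler's identity for 2-forms. -/
theorem sum_ι_mul_contractLeft_coord {I : Type*} [Fintype I] (e : Module.Basis I R M)
    {a : ExteriorAlgebra R M} (ha : a ∈ ⋀[R]^2 M) :
    ∑ i, ι R (e i) * contractLeft (e.coord i) a = (2 : R) • a := by
  refine induction_two_form ha (fun u v => ?_) (fun x y hx hy => ?_)
  · have key (u v : M) : ∑ i, ι R (e i) * ι R (e.coord i u • v) = ι R u * ι R v := by
      conv_rhs => rw [← e.sum_repr u, map_sum, Finset.sum_mul]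
      simp only [map_smul, mul_smul_comm, smul_mul_assoc, Module.Basis.coord_apply]
    simp only [contractLeft_ι_mul_ι]
    simp only [map_sub (ι R), mul_sub, Finset.sum_sub_distrib]
    rw [key, key, ι_mul_ι_swap v u, sub_neg_eq_add, two_smul]
  · simp only [map_add, mul_add, Finset.sum_add_distrib, hx, hy, smul_add]

end CommRing

variable {K M : Type*} [Field K] [NeZero (2 : K)] [AddCommGroup M] [Module K M]
  [FiniteDimensional K M]

theorem exists_contractLeft_ne_zero_of_mem_two {a : ExteriorAlgebra K M} (ha : a ∈ ⋀[K]^2 M)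
    (h0 : a ≠ 0) : ∃ d : Module.Dual K M, contractLeft d a ≠ 0 := by
  by_contra! h
  have euler := sum_ι_mul_contractLeft_coord (Module.finBasis K M) ha
  simp only [h, mul_zero, Finset.sum_const_zero] at euler
  exact (smul_ne_zero two_ne_zero h0) euler.symm

theorem pow_three_eq_zero_of_mul_eq_zero {a b : ExteriorAlgebra K M} (ha : a ∈ ⋀[K]^2 M)
    (hb : b ∈ ⋀[K]^2 M) (hb0 : b ≠ 0) (hab : a * b = 0) : a ^ 3 = 0 := by
  obtain ⟨x, hx⟩ := exists_contractLeft_ne_zero_of_mem_two hb hb0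
  obtain ⟨r, hr⟩ := exists_contractLeft_eq_ι_of_mem_two hb x
  have hr0 : r ≠ 0 := by
    rintro rfl
    exact hx (by rw [hr, map_zero])
  obtain ⟨y, hy⟩ : ∃ y : Module.Dual K M, y r ≠ 0 := by
    by_contra! h
    exact hr0 ((Module.forall_dual_apply_eq_zero_iff K r).mp h)
  obtain ⟨s, hs⟩ := exists_contractLeft_eq_ι_of_mem_two hb y
  obtain ⟨p, hp⟩ := exists_contractLeft_eq_ι_of_mem_two ha x
  obtain ⟨q, hq⟩ := exists_contractLeft_eq_ι_of_mem_two ha y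
  have hxab : ι K p * b + a * ι K r = 0 := by
    rw [← hp, ← hr, ← contractLeft_mul_of_mem_two ha, hab, map_zero]
  have hyab : ι K q * b + a * ι K s = 0 := by
    rw [← hq, ← hs, ← contractLeft_mul_of_mem_two ha, hab, map_zero]
  have hyxab := congrArg (contractLeft y) hxab
  rw [map_add, map_zero, contractLeft_ι_mul, contractLeft_mul_of_mem_two ha, contractLeft_ι, hs,
    hq, ← Algebra.commutes, ← Algebra.smul_def] at hyxab
  have vanish (u v w : M) (h : ι K v * b + a * ι K w = 0) : a * (a * (ι K u * ι K w)) = 0 := by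
    have hau := (commute_ι_of_mem_two ha u).eq
    have hav := (commute_ι_of_mem_two ha v).eq
    calc a * (a * (ι K u * ι K w)) = a * ι K u * (a * ι K w) := by
          simp only [mul_assoc]; rw [← mul_assoc a (ι K u) (ι K w), hau, mul_assoc]
      _ = -(ι K u * (a * ι K v) * b) := by
          rw [eq_neg_of_add_eq_zero_right h, hau]; simp only [mul_neg, mul_assoc]
      _ = 0 := by rw [hav]; simp only [mul_assoc, hab, mul_zero, neg_zero]
  have hmul := congrArg (fun z => a * (a * z)) hyxab
  simp only [mul_add, mul_sub, mul_smul_comm, hab, vanish p q s hyab, vanish q p r hxab, mul_zero,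
    smul_zero, sub_zero, zero_add] at hmul
  rw [pow_three]
  exact (smul_eq_zero.mp hmul).resolve_left hy

end ExteriorAlgebra

/-!
STATEMENT 3: If `ω₁`, `ω₂` are nonzero alternating 2-forms on a finite-dimensional real
vector space with `ω₁ ∧ ω₂ = 0`, then both have rank at most 2, i.e. `ω₁^3 = 0` and
`ω₂^3 = 0`.  Forms are modelled as elements of the exterior powers of the dual space,
with the wedge product given by multiplication in the exterior algebra.
-/
theorem statement3 (V : Type*) [AddCommGroup V] [Module ℝ V] [FiniteDimensional ℝ V]
    (ω₁ ω₂ : ⋀[ℝ]^2 (Module.Dual ℝ V)) (h1 : ω₁ ≠ 0) (h2 : ω₂ ≠ 0)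
    (h : (ω₁ : ExteriorAlgebra ℝ (Module.Dual ℝ V)) * (ω₂ : ExteriorAlgebra ℝ (Module.Dual ℝ V))
      = 0) :
    (ω₁ : ExteriorAlgebra ℝ (Module.Dual ℝ V)) ^ 3 = 0 ∧
    (ω₂ : ExteriorAlgebra ℝ (Module.Dual ℝ V)) ^ 3 = 0 := by
  have h' : (ω₂ : ExteriorAlgebra ℝ (Module.Dual ℝ V)) * ω₁ = 0 := by
    rw [← h]; exact (ExteriorAlgebra.commute_of_mem_two ω₂.2 ω₁.2).eq
  exact ⟨ExteriorAlgebra.pow_three_eq_zero_of_mul_eq_zero ω₁.2 ω₂.2 (by simpa using h2) h,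
    ExteriorAlgebra.pow_three_eq_zero_of_mul_eq_zero ω₂.2 ω₁.2 (by simpa using h1) h'⟩
end

section
/- Let V be a real vector space of dimension 2p and ω an alternating 2-form on V with ω^{∧p} ≠ 0. Then the linear map λ^{p−1} from the space of alternating (p−1)-forms on V to the space of alternating (p+1)-forms on V, given by β ↦ ω ∧ β, is a linear isomorphism. -/
set_option synthInstance.maxHeartbeats 1000000
set_option maxHeartbeats 1000000

namespace ExteriorAlgebra

section CommRing

variable {R M : Type*} [CommRing R] [AddCommGroup M] [Module R M]

/-- Interior multiplication by a linear functional on the exterior algebra. -/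
noncomputable def contract (d : Module.Dual R M) :
    ExteriorAlgebra R M →ₗ[R] ExteriorAlgebra R M :=
  CliffordAlgebra.contractLeft (Q := (0 : QuadraticForm R M)) d

theorem contract_ι_mul (d : Module.Dual R M) (a : M) (x : ExteriorAlgebra R M) :
    contract d (ι R a * x) = d a • x - ι R a * contract d x :=
  CliffordAlgebra.contractLeft_ι_mul (Q := (0 : QuadraticForm R M)) d a x

theorem exteriorPower_zero : ⋀[R]^0 M = 1 := pow_zero _

theorem exteriorPower_one : ⋀[R]^1 M = LinearMap.range (ι R : M →ₗ[R] ExteriorAlgebra R M) :=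
  pow_one _

theorem exteriorPower_succ (k : ℕ) :
    ⋀[R]^(k + 1) M = LinearMap.range (ι R : M →ₗ[R] ExteriorAlgebra R M) * ⋀[R]^k M :=
  pow_succ' _ _

theorem exteriorPower_two :
    ⋀[R]^2 M = LinearMap.range (ι R : M →ₗ[R] ExteriorAlgebra R M) *
      LinearMap.range (ι R : M →ₗ[R] ExteriorAlgebra R M) :=
  pow_two _

theorem exteriorPower_add (k l : ℕ) : ⋀[R]^(k + l) M = ⋀[R]^k M * ⋀[R]^l M := pow_add _ _ _

theorem contract_ι (d : Module.Dual R M) (a : M) :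
    contract d (ι R a) = algebraMap R _ (d a) :=
  CliffordAlgebra.contractLeft_ι (Q := (0 : QuadraticForm R M)) d a

theorem contract_algebraMap (d : Module.Dual R M) (r : R) :
    contract d (algebraMap R (ExteriorAlgebra R M) r) = 0 :=
  CliffordAlgebra.contractLeft_algebraMap (Q := (0 : QuadraticForm R M)) d r

theorem contract_mem_exteriorPower (d : Module.Dual R M) {k : ℕ} {x : ExteriorAlgebra R M}
    (hx : x ∈ ⋀[R]^(k + 1) M) : contract d x ∈ ⋀[R]^k M := by
  induction k generalizing x with
  | zero =>
    rw [zero_add, exteriorPower_one] at hx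
    obtain ⟨a, rfl⟩ := hx
    rw [contract_ι, exteriorPower_zero]
    exact Submodule.algebraMap_mem _
  | succ k ih =>
    rw [exteriorPower_succ] at hx
    induction hx using Submodule.mul_induction_on' with
    | mem_mul_mem a ha y hy =>
      obtain ⟨a, rfl⟩ := ha
      rw [contract_ι_mul]
      refine sub_mem (Submodule.smul_mem _ _ hy) ?_
      rw [exteriorPower_succ]
      exact Submodule.mul_mem_mul ⟨a, rfl⟩ (ih hy)
    | add x _ y _ hx hy => rw [map_add]; exact add_mem hx hy

theorem ι_mul_ι_comm (a b : M) : ι R a * ι R b = -(ι R b * ι R a) :=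
  eq_neg_of_add_eq_zero_left (ι_add_mul_swap a b)

theorem commute_of_mem_exteriorPower_two {w : ExteriorAlgebra R M} (hw : w ∈ ⋀[R]^2 M)
    (x : ExteriorAlgebra R M) : Commute w x := by
  rw [exteriorPower_two] at hw
  induction hw using Submodule.mul_induction_on' with
  | mem_mul_mem a ha b hb =>
    obtain ⟨a, rfl⟩ := ha
    obtain ⟨b, rfl⟩ := hb
    induction x using ExteriorAlgebra.induction with
    | algebraMap r => exact Algebra.commute_algebraMap_right r _
    | ι c =>
      change ι R a * ι R b * ι R c = ι R c * (ι R a * ι R b)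
      rw [mul_assoc, ι_mul_ι_comm b c, mul_neg, ← mul_assoc, ι_mul_ι_comm a c, neg_mul, neg_neg,
        mul_assoc]
    | mul x y hx hy => exact hx.mul_right hy
    | add x y hx hy => exact hx.add_right hy
  | add x _ y _ hx hy => exact hx.add_left hy

theorem contract_mul_of_mem_exteriorPower_two (d : Module.Dual R M) {w : ExteriorAlgebra R M}
    (hw : w ∈ ⋀[R]^2 M) (x : ExteriorAlgebra R M) :
    contract d (w * x) = contract d w * x + w * contract d x := by
  rw [exteriorPower_two] at hw
  induction hw using Submodule.mul_induction_on' with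
  | mem_mul_mem a ha b hb =>
    obtain ⟨a, rfl⟩ := ha
    obtain ⟨b, rfl⟩ := hb
    simp only [mul_assoc, contract_ι_mul, contract_ι, sub_mul, mul_sub, smul_mul_assoc,
      mul_smul_comm, ← Algebra.smul_def, ← Algebra.commutes (d b) (ι R a)]
    abel
  | add x _ y _ hx hy => simp only [add_mul, map_add, hx, hy]; abel

theorem mul_contract_pow_mul (d : Module.Dual R M) {w : ExteriorAlgebra R M}
    (hw : w ∈ ⋀[R]^2 M) (n : ℕ) (x : ExteriorAlgebra R M) :
    w * contract d (w ^ n * x) =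
      n • (contract d w * (w ^ n * x)) + w ^ (n + 1) * contract d x := by
  induction n with
  | zero => simp
  | succ n ih =>
    have hcomm := (commute_of_mem_exteriorPower_two hw (contract d w)).eq
    rw [pow_succ' w n, mul_assoc, contract_mul_of_mem_exteriorPower_two d hw, ih, mul_add,
      mul_add, ← mul_assoc w (contract d w), hcomm, mul_smul_comm, ← mul_assoc w (contract d w),
      hcomm, pow_succ' w (n + 1), succ_nsmul]
    simp only [mul_assoc]
    abel

/-- Euler's formula for the interior product. -/
theorem sum_ι_mul_contract_coord {I : Type*} [Fintype I] (b : Module.Basis I R M) {k : ℕ}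
    {x : ExteriorAlgebra R M} (hx : x ∈ ⋀[R]^k M) :
    ∑ i, ι R (b i) * contract (b.coord i) x = k • x := by
  induction k generalizing x with
  | zero =>
    rw [exteriorPower_zero] at hx
    obtain ⟨r, rfl⟩ := Submodule.mem_one.mp hx
    simp [contract_algebraMap]
  | succ k ih =>
    rw [exteriorPower_succ] at hx
    induction hx using Submodule.mul_induction_on' with
    | mem_mul_mem a ha y hy =>
      obtain ⟨a, rfl⟩ := ha
      have h (i : I) : ι R (b i) * contract (b.coord i) (ι R a * y) =
          ι R (b.repr a i • b i) * y + ι R a * (ι R (b i) * contract (b.coord i) y) := by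
        rw [contract_ι_mul, mul_sub, ← mul_assoc, ι_mul_ι_comm (b i) a, neg_mul, sub_neg_eq_add,
          mul_assoc, mul_smul_comm, map_smul, smul_mul_assoc, Module.Basis.coord_apply]
      rw [Finset.sum_congr rfl fun i _ => h i, Finset.sum_add_distrib, ← Finset.sum_mul,
        ← Finset.mul_sum, ← map_sum, b.sum_repr, ih hy, succ_nsmul', mul_smul_comm]
    | add x _ y _ hx hy => simp only [map_add, mul_add, Finset.sum_add_distrib, hx, hy, smul_add]

end CommRing

section Field

variable {K M : Type*} [Field K] [CharZero K] [AddCommGroup M] [Module K M]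
  [FiniteDimensional K M]

theorem eq_zero_of_contract_eq_zero {k : ℕ} {x : ExteriorAlgebra K M}
    (hx : x ∈ ⋀[K]^(k + 1) M) (h : ∀ d : Module.Dual K M, contract d x = 0) : x = 0 := by
  have euler := sum_ι_mul_contract_coord (Module.finBasis K M) hx
  simp only [h, mul_zero, Finset.sum_const_zero] at euler
  rw [← Nat.cast_smul_eq_nsmul K] at euler
  exact (smul_eq_zero.mp euler.symm).resolve_left (Nat.cast_ne_zero.mpr k.succ_ne_zero)

theorem eq_zero_of_pow_mul_eq_zero {w : ExteriorAlgebra K M} (hw : w ∈ ⋀[K]^2 M) {j k : ℕ}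
    (hne : w ^ (j + k) ≠ 0) {x : ExteriorAlgebra K M} (hx : x ∈ ⋀[K]^k M)
    (h : w ^ j * x = 0) : x = 0 := by
  induction k generalizing j x with
  | zero =>
    rw [exteriorPower_zero] at hx
    obtain ⟨r, rfl⟩ := Submodule.mem_one.mp hx
    rw [← Algebra.commutes, ← Algebra.smul_def] at h
    rw [(smul_eq_zero.mp h).resolve_right hne, map_zero]
  | succ k ih =>
    refine eq_zero_of_contract_eq_zero hx fun d => ?_
    refine ih (j := j + 1) (by rwa [add_right_comm]) (contract_mem_exteriorPower d hx) ?_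
    simpa [h] using (mul_contract_pow_mul d hw j x).symm

end Field

end ExteriorAlgebra

/-!
STATEMENT 6: If `V` is a real vector space of dimension `2p` and `ω` is an alternating
2-form with `ω^p ≠ 0`, then `λ^{p-1} : β ↦ ω ∧ β` is a linear isomorphism from
`(p-1)`-forms onto `(p+1)`-forms; since `β ↦ ω ∧ β` is linear, this is expressed by saying
that it is injective on `⋀[ℝ]^(p-1) (V^*)` and that every `(p+1)`-form is of the form
`ω ∧ β`.  Forms of degree `k` are modelled as elements of `⋀[ℝ]^k (V^*)`, with the wedge
product given by multiplication in the exterior algebra of the dual space.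
-/
theorem statement6 (V : Type*) [AddCommGroup V] [Module ℝ V] [FiniteDimensional ℝ V]
    (p : ℕ) (hp : 1 ≤ p) (hdim : Module.finrank ℝ V = 2 * p)
    (ω : ⋀[ℝ]^2 (Module.Dual ℝ V))
    (hω : (ω : ExteriorAlgebra ℝ (Module.Dual ℝ V)) ^ p ≠ 0) :
    (Function.Injective (fun β : ⋀[ℝ]^(p - 1) (Module.Dual ℝ V) =>
      (ω : ExteriorAlgebra ℝ (Module.Dual ℝ V)) * (β : ExteriorAlgebra ℝ (Module.Dual ℝ V)))) ∧
    (∀ κ : ⋀[ℝ]^(p + 1) (Module.Dual ℝ V), ∃ β : ⋀[ℝ]^(p - 1) (Module.Dual ℝ V),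
      (ω : ExteriorAlgebra ℝ (Module.Dual ℝ V)) * (β : ExteriorAlgebra ℝ (Module.Dual ℝ V))
        = (κ : ExteriorAlgebra ℝ (Module.Dual ℝ V))) := by
  obtain ⟨q, rfl⟩ : ∃ q, p = q + 1 := ⟨p - 1, by omega⟩
  rw [Nat.add_sub_cancel]
  have hmem (β : ⋀[ℝ]^q (Module.Dual ℝ V)) :
      (ω : ExteriorAlgebra ℝ (Module.Dual ℝ V)) * β ∈ ⋀[ℝ]^(q + 1 + 1) (Module.Dual ℝ V) := by
    rw [add_assoc, add_comm q, ExteriorAlgebra.exteriorPower_add]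
    exact Submodule.mul_mem_mul ω.2 β.2
  let L : ⋀[ℝ]^q (Module.Dual ℝ V) →ₗ[ℝ] ⋀[ℝ]^(q + 1 + 1) (Module.Dual ℝ V) :=
    ((LinearMap.mulLeft ℝ (ω : ExteriorAlgebra ℝ (Module.Dual ℝ V))) ∘ₗ
      Submodule.subtype _).codRestrict _ hmem
  have hL : Function.Injective L := by
    refine (injective_iff_map_eq_zero L).mpr fun β hβ => Subtype.ext ?_
    refine ExteriorAlgebra.eq_zero_of_pow_mul_eq_zero ω.2 (j := 1)
      (by rwa [add_comm]) β.2 ?_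
    rw [pow_one]
    exact congrArg Subtype.val hβ
  have hrank : Module.finrank ℝ (⋀[ℝ]^q (Module.Dual ℝ V)) =
      Module.finrank ℝ (⋀[ℝ]^(q + 1 + 1) (Module.Dual ℝ V)) := by
    rw [exteriorPower.finrank_eq, exteriorPower.finrank_eq, Subspace.dual_finrank_eq, hdim]
    exact Nat.choose_symm_of_eq_add (by omega)
  refine ⟨fun β γ h => hL (Subtype.ext h), fun κ => ?_⟩
  obtain ⟨β, hβ⟩ := (LinearMap.injective_iff_surjective_of_finrank_eq_finrank hrank).mp hL κ
  exact ⟨β, congrArg Subtype.val hβ⟩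
end
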